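/- arXiv:2405.20494 — 2 statements merged into one kernel-verified Lean document; each statement's English description precedes it below -/
import Mathlib

section
/- Let x₁,…,x_n ∈ ℝ^d with empirical mean μ̂ and empirical covariance Σ̂, let r ∈ ℝ, σ > 0, γ > 0, and let c ∈ ℝ^p be a standard basis vector (so ‖c‖₂ = 1). Define J^c(W, V) := (1/n) Σ_{i=1}^n E_{ε ~ N(0,I_d), ξ ~ N(0,I_p)} ‖ r W x_i + σ W ε + V(c + γ ξ) − ε ‖₂², with ε, ξ independent, over W ∈ ℝ^{d×d} and V ∈ ℝ^{d×p}. Set A := σ² I_d + r² Σ̂ + (r² γ²/(1+γ²)) μ̂ μ̂ᵀ, which is positive definite. Then J^c has a unique global minimizer (W*, V*), given by W* = σ A^{-1} and V* = b* cᵀ, where b* = − (r σ/(1+γ²)) A^{-1} μ̂. -/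
open MeasureTheory ProbabilityTheory Matrix

/-- The squared Euclidean norm `‖x‖₂²` on `ℝ^d`. -/
noncomputable def sqNorm {d : ℕ} (x : Fin d → ℝ) : ℝ := ∑ i, x i ^ 2

/-- The standard Gaussian measure `N(0, I_d)` on `ℝ^d`. -/
noncomputable def stdGaussian (d : ℕ) : Measure (Fin d → ℝ) :=
  Measure.pi fun _ => gaussianReal 0 1

/-- Empirical mean `μ̂ = (1/n) ∑ᵢ xᵢ`. -/
noncomputable def empMean {d n : ℕ} (x : Fin n → Fin d → ℝ) : Fin d → ℝ :=
  (n : ℝ)⁻¹ • ∑ i, x i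

/-- Empirical covariance `Σ̂ = (1/n) ∑ᵢ xᵢxᵢᵀ − μ̂μ̂ᵀ`. -/
noncomputable def empCov {d n : ℕ} (x : Fin n → Fin d → ℝ) : Matrix (Fin d) (Fin d) ℝ :=
  (n : ℝ)⁻¹ • ∑ i, vecMulVec (x i) (x i) - vecMulVec (empMean x) (empMean x)

section GaussianMoments

instance isProbabilityMeasure_stdGaussian_pi (d : ℕ) :
    IsProbabilityMeasure (_root_.stdGaussian d) := by
  unfold _root_.stdGaussian; infer_instance

lemma memLp_stdGaussian_eval {d : ℕ} (j : Fin d) :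
    MemLp (fun y : Fin d → ℝ => y j) 2 (_root_.stdGaussian d) :=
  (memLp_id_gaussianReal 2).comp_measurePreserving (measurePreserving_eval _ j)

lemma memLp_stdGaussian_dotProduct {d : ℕ} (m : Fin d → ℝ) :
    MemLp (fun y => m ⬝ᵥ y) 2 (_root_.stdGaussian d) :=
  memLp_finsetSum _ fun j _ => (memLp_stdGaussian_eval j).const_mul (m j)

lemma integral_stdGaussian_dotProduct {d : ℕ} (m : Fin d → ℝ) :
    ∫ y, m ⬝ᵥ y ∂(_root_.stdGaussian d) = 0 := by
  simp only [dotProduct]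
  rw [integral_finsetSum _ fun j _ =>
    ((memLp_stdGaussian_eval j).integrable (by norm_num)).const_mul (m j)]
  refine Finset.sum_eq_zero fun j _ => ?_
  have h := integral_comp_eval (μ := fun _ : Fin d => gaussianReal 0 1) (i := j)
    (f := fun t : ℝ => t) (by fun_prop)
  rw [integral_const_mul, _root_.stdGaussian, h, integral_id_gaussianReal, mul_zero]

lemma variance_stdGaussian_dotProduct {d : ℕ} (m : Fin d → ℝ) :
    Var[fun y => m ⬝ᵥ y; _root_.stdGaussian d] = m ⬝ᵥ m := by
  have h := variance_sum_pi (μ := fun _ : Fin d => gaussianReal 0 1)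
    (X := fun j t => m j * t) fun j => (memLp_id_gaussianReal 2).const_mul (m j)
  have e : (∑ j, fun y : Fin d → ℝ => m j * y j) = fun y => m ⬝ᵥ y := by
    ext y; simp [dotProduct]
  rw [e] at h
  rw [_root_.stdGaussian, h]
  refine Finset.sum_congr rfl fun j _ => ?_
  rw [variance_const_mul, variance_fun_id_gaussianReal, NNReal.coe_one, mul_one, pow_two]

lemma integral_sq_add_stdGaussian_dotProduct {d : ℕ} (a : ℝ) (m : Fin d → ℝ) :
    ∫ y, (a + m ⬝ᵥ y) ^ 2 ∂(_root_.stdGaussian d) = a ^ 2 + m ⬝ᵥ m := by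
  have hm := memLp_stdGaussian_dotProduct m
  have h := variance_eq_sub ((memLp_const a).add hm)
  have hv : Var[(fun _ => a) + fun y => m ⬝ᵥ y; _root_.stdGaussian d] = m ⬝ᵥ m := by
    rw [← variance_stdGaussian_dotProduct m]
    exact variance_const_add hm.aestronglyMeasurable a
  have hi : ∫ y, ((fun _ => a) + fun y => m ⬝ᵥ y : (Fin d → ℝ) → ℝ) y ∂(_root_.stdGaussian d) = a := by
    simp only [Pi.add_apply]
    rw [integral_add (integrable_const a) (hm.integrable (by norm_num)),
      integral_stdGaussian_dotProduct]
    simp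
  rw [hv, hi] at h
  simp only [Pi.pow_apply, Pi.add_apply] at h
  linarith

lemma memLp_affine_prod_stdGaussian {d p : ℕ} (a : ℝ) (m : Fin d → ℝ) (l : Fin p → ℝ) :
    MemLp (fun q : (Fin d → ℝ) × (Fin p → ℝ) => a + m ⬝ᵥ q.1 + l ⬝ᵥ q.2) 2
      ((_root_.stdGaussian d).prod (_root_.stdGaussian p)) :=
  ((memLp_const a).add ((memLp_stdGaussian_dotProduct m).comp_fst _)).add
    ((memLp_stdGaussian_dotProduct l).comp_snd _)

lemma integral_sq_affine_prod_stdGaussian {d p : ℕ} (a : ℝ) (m : Fin d → ℝ) (l : Fin p → ℝ) :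
    ∫ q, (a + m ⬝ᵥ q.1 + l ⬝ᵥ q.2) ^ 2 ∂((_root_.stdGaussian d).prod (_root_.stdGaussian p)) =
      a ^ 2 + m ⬝ᵥ m + l ⬝ᵥ l := by
  rw [integral_prod _ (memLp_affine_prod_stdGaussian a m l).integrable_sq]
  simp only [integral_sq_add_stdGaussian_dotProduct]
  have hm : Integrable (fun y => (a + m ⬝ᵥ y) ^ 2) (_root_.stdGaussian d) :=
    ((memLp_const a).add (memLp_stdGaussian_dotProduct m)).integrable_sq
  rw [integral_add hm (integrable_const _), integral_sq_add_stdGaussian_dotProduct]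
  simp

lemma integral_sqNorm_affine_prod_stdGaussian {k d p : ℕ} (a : Fin k → ℝ)
    (M : Matrix (Fin k) (Fin d) ℝ) (N : Matrix (Fin k) (Fin p) ℝ) :
    ∫ q, sqNorm (a + M *ᵥ q.1 + N *ᵥ q.2)
        ∂((_root_.stdGaussian d).prod (_root_.stdGaussian p)) =
      ∑ i, (a i ^ 2 + M i ⬝ᵥ M i + N i ⬝ᵥ N i) := by
  simp only [sqNorm, Pi.add_apply, mulVec]
  rw [integral_finsetSum _ fun i _ =>
    (memLp_affine_prod_stdGaussian (a i) (M i) (N i)).integrable_sq]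
  exact Finset.sum_congr rfl fun i _ => integral_sq_affine_prod_stdGaussian _ _ _

end GaussianMoments

section Quadratic

variable {d p n : ℕ}

/-- The contribution of a single output coordinate to the objective, for regression target `e`. -/
noncomputable def rowLoss (x : Fin n → Fin d → ℝ) (r σ γ : ℝ) (j₀ : Fin p)
    (e w : Fin d → ℝ) (v : Fin p → ℝ) : ℝ :=
  (n : ℝ)⁻¹ * ∑ i, (r * (w ⬝ᵥ x i) + v j₀) ^ 2 + (σ • w - e) ⬝ᵥ (σ • w - e) + γ ^ 2 * (v ⬝ᵥ v)

lemma inv_mul_sum_integral_sqNorm (hn : 0 < n) (x : Fin n → Fin d → ℝ) (r σ γ : ℝ) (j₀ : Fin p)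
    (W : Matrix (Fin d) (Fin d) ℝ) (V : Matrix (Fin d) (Fin p) ℝ) :
    (n : ℝ)⁻¹ * ∑ i,
        ∫ q, sqNorm (r • (W *ᵥ x i) + σ • (W *ᵥ q.1) + V *ᵥ (Pi.single j₀ 1 + γ • q.2) - q.1)
          ∂((_root_.stdGaussian d).prod (_root_.stdGaussian p)) =
      ∑ k, rowLoss x r σ γ j₀ (Pi.single k 1) (W k) (V k) := by
  have hn' : (n : ℝ) ≠ 0 := by positivity
  have e : ∀ i (q : (Fin d → ℝ) × (Fin p → ℝ)),
      r • (W *ᵥ x i) + σ • (W *ᵥ q.1) + V *ᵥ (Pi.single j₀ 1 + γ • q.2) - q.1 =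
        (r • (W *ᵥ x i) + V.col j₀) + (σ • W - 1) *ᵥ q.1 + (γ • V) *ᵥ q.2 := by
    intro i q
    rw [mulVec_add, mulVec_single_one, sub_mulVec, smul_mulVec, smul_mulVec, one_mulVec,
      mulVec_smul]
    abel
  have h1 : ∀ k, (σ • W - 1) k = σ • W k - Pi.single k 1 := by
    intro k; ext j; simp [Matrix.one_apply, Pi.single_apply, eq_comm]
  have h2 : ∀ k, (γ • V) k ⬝ᵥ (γ • V) k = γ ^ 2 * (V k ⬝ᵥ V k) := by
    intro k
    change (γ • V k) ⬝ᵥ (γ • V k) = _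
    simp [pow_two, mul_assoc]
  simp only [e, integral_sqNorm_affine_prod_stdGaussian, rowLoss, h1, h2]
  rw [Finset.sum_comm, Finset.mul_sum]
  refine Finset.sum_congr rfl fun k _ => ?_
  simp only [Finset.sum_add_distrib, Finset.sum_const, Finset.card_univ, Fintype.card_fin,
    nsmul_eq_mul, mul_add, inv_mul_cancel_left₀ hn']
  rfl

lemma rowLoss_zero_nonneg (x : Fin n → Fin d → ℝ) (r σ γ : ℝ) (j₀ : Fin p)
    (w : Fin d → ℝ) (v : Fin p → ℝ) : 0 ≤ rowLoss x r σ γ j₀ 0 w v := by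
  have h1 := dotProduct_self_star_nonneg (σ • w - 0)
  have h2 := dotProduct_self_star_nonneg v
  simp only [star_trivial] at h1 h2
  unfold rowLoss
  positivity

lemma eq_zero_of_rowLoss_zero_eq_zero {x : Fin n → Fin d → ℝ} {r σ γ : ℝ} (hσ : 0 < σ)
    (hγ : 0 < γ) {j₀ : Fin p} {w : Fin d → ℝ} {v : Fin p → ℝ}
    (h : rowLoss x r σ γ j₀ 0 w v = 0) : w = 0 ∧ v = 0 := by
  have h1 := dotProduct_self_star_nonneg w
  have h2 := dotProduct_self_star_nonneg v
  simp only [star_trivial] at h1 h2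
  have h3 : 0 ≤ (n : ℝ)⁻¹ * ∑ i, (r * (w ⬝ᵥ x i) + v j₀) ^ 2 := by positivity
  simp only [rowLoss, sub_zero, smul_dotProduct, dotProduct_smul, smul_eq_mul] at h
  have h4 : 0 ≤ σ * (σ * (w ⬝ᵥ w)) := by positivity
  have h5 : 0 ≤ γ ^ 2 * (v ⬝ᵥ v) := by positivity
  have h6 : σ * (σ * (w ⬝ᵥ w)) = 0 := by linarith
  have h7 : γ ^ 2 * (v ⬝ᵥ v) = 0 := by linarith
  constructor
  · simpa [hσ.ne'] using h6
  · simpa [hγ.ne'] using h7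

lemma dotProduct_empMean (x : Fin n → Fin d → ℝ) (w : Fin d → ℝ) :
    w ⬝ᵥ empMean x = (n : ℝ)⁻¹ * ∑ i, w ⬝ᵥ x i := by
  simp [empMean, dotProduct_sum]

lemma dotProduct_empCov_mulVec (x : Fin n → Fin d → ℝ) (u w : Fin d → ℝ) :
    u ⬝ᵥ (empCov x *ᵥ w) =
      (n : ℝ)⁻¹ * ∑ i, (u ⬝ᵥ x i) * (w ⬝ᵥ x i) - (u ⬝ᵥ empMean x) * (w ⬝ᵥ empMean x) := by
  simp [empCov, sub_mulVec, smul_mulVec, sum_mulVec, vecMulVec_mulVec, dotProduct_sub,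
    dotProduct_sum, dotProduct_comm w, mul_comm]

lemma posSemidef_empCov (x : Fin n → Fin d → ℝ) : (empCov x).PosSemidef := by
  rcases Nat.eq_zero_or_pos n with rfl | hn
  · simpa [empCov, empMean] using PosSemidef.zero
  have hn' : (n : ℝ) ≠ 0 := by positivity
  refine .of_dotProduct_mulVec_nonneg ?_ fun w => ?_
  · ext i j
    simp [empCov, vecMulVec_apply, Matrix.sum_apply, mul_comm]
  · rw [star_trivial, dotProduct_empCov_mulVec]
    have h : (n : ℝ)⁻¹ * ∑ i, (w ⬝ᵥ x i) * (w ⬝ᵥ x i) - (w ⬝ᵥ empMean x) * (w ⬝ᵥ empMean x) =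
        (n : ℝ)⁻¹ * ∑ i, (w ⬝ᵥ x i - w ⬝ᵥ empMean x) ^ 2 := by
      have hs : ∑ i, w ⬝ᵥ x i = n * (w ⬝ᵥ empMean x) := by
        rw [dotProduct_empMean, mul_inv_cancel_left₀ hn']
      simp only [sub_sq, Finset.sum_add_distrib, Finset.sum_sub_distrib, ← Finset.sum_mul,
        ← Finset.mul_sum, hs, Finset.sum_const, Finset.card_univ, Fintype.card_fin, nsmul_eq_mul]
      field_simp
      ring
    rw [h]
    positivity

lemma posDef_smul_one_add_empCov_add (x : Fin n → Fin d → ℝ) {r σ γ : ℝ} (hσ : 0 < σ) :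
    (σ ^ 2 • (1 : Matrix (Fin d) (Fin d) ℝ) + r ^ 2 • empCov x +
        (r ^ 2 * γ ^ 2 / (1 + γ ^ 2)) • vecMulVec (empMean x) (empMean x)).PosDef := by
  have h := posSemidef_vecMulVec_self_star (empMean x)
  rw [star_trivial] at h
  exact ((PosDef.one.smul (by positivity)).add_posSemidef
    ((posSemidef_empCov x).smul (by positivity))).add_posSemidef (h.smul (by positivity))

lemma rowLoss_eq_add (hn : 0 < n) (x : Fin n → Fin d → ℝ) (r σ γ : ℝ) (j₀ : Fin p)
    {e w₀ : Fin d → ℝ}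
    (hw : (σ ^ 2 • (1 : Matrix (Fin d) (Fin d) ℝ) + r ^ 2 • empCov x +
        (r ^ 2 * γ ^ 2 / (1 + γ ^ 2)) • vecMulVec (empMean x) (empMean x)) *ᵥ w₀ = σ • e)
    {v₀ : Fin p → ℝ} (hv : v₀ = Pi.single j₀ (-(r / (1 + γ ^ 2)) * (w₀ ⬝ᵥ empMean x)))
    (w : Fin d → ℝ) (v : Fin p → ℝ) :
    rowLoss x r σ γ j₀ e w v =
      rowLoss x r σ γ j₀ e w₀ v₀ + rowLoss x r σ γ j₀ 0 (w - w₀) (v - v₀) := by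
  obtain ⟨δ, rfl⟩ : ∃ δ, w = w₀ + δ := ⟨w - w₀, by simp⟩
  obtain ⟨η, rfl⟩ : ∃ η, v = v₀ + η := ⟨v - v₀, by simp⟩
  have hn' : (n : ℝ) ≠ 0 := by positivity
  have hγ' : 1 + γ ^ 2 ≠ 0 := by positivity
  have hδ := congrArg (fun u => δ ⬝ᵥ u) hw
  simp only [add_mulVec, smul_mulVec, one_mulVec, dotProduct_add, dotProduct_smul, smul_eq_mul,
    dotProduct_empCov_mulVec, vecMulVec_mulVec, op_smul_eq_smul] at hδ
  rw [dotProduct_comm (empMean x) w₀] at hδ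
  have hv₀ : v₀ j₀ = -(r / (1 + γ ^ 2)) * (w₀ ⬝ᵥ empMean x) := by simp [hv]
  have hη : v₀ ⬝ᵥ η = v₀ j₀ * η j₀ := by rw [hv]; simp
  have hη' : η ⬝ᵥ v₀ = v₀ j₀ * η j₀ := by rw [dotProduct_comm, hη]
  have hs : ∑ i, (r * ((w₀ + δ) ⬝ᵥ x i) + (v₀ + η) j₀) ^ 2 =
      ∑ i, (r * (w₀ ⬝ᵥ x i) + v₀ j₀) ^ 2 + ∑ i, (r * (δ ⬝ᵥ x i) + η j₀) ^ 2 +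
        2 * (r ^ 2 * ∑ i, (δ ⬝ᵥ x i) * (w₀ ⬝ᵥ x i) + r * v₀ j₀ * ∑ i, δ ⬝ᵥ x i +
          r * η j₀ * ∑ i, w₀ ⬝ᵥ x i + n * (v₀ j₀ * η j₀)) := by
    have hc : (n : ℝ) * (v₀ j₀ * η j₀) = ∑ _i : Fin n, v₀ j₀ * η j₀ := by simp
    rw [hc]
    simp only [Finset.mul_sum, ← Finset.sum_add_distrib]
    refine Finset.sum_congr rfl fun i _ => ?_
    rw [add_dotProduct, Pi.add_apply]
    ring
  have hδμ : ∑ i, δ ⬝ᵥ x i = n * (δ ⬝ᵥ empMean x) := by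
    rw [dotProduct_empMean, mul_inv_cancel_left₀ hn']
  have hwμ : ∑ i, w₀ ⬝ᵥ x i = n * (w₀ ⬝ᵥ empMean x) := by
    rw [dotProduct_empMean, mul_inv_cancel_left₀ hn']
  unfold rowLoss
  rw [hs, hδμ, hwμ]
  simp only [add_sub_cancel_left, sub_zero, smul_add, add_dotProduct, dotProduct_add,
    sub_dotProduct, dotProduct_sub, smul_dotProduct, dotProduct_smul, smul_eq_mul, hη, hη',
    dotProduct_comm w₀ δ, dotProduct_comm e δ, dotProduct_comm e w₀]
  generalize hS : ∑ i, (δ ⬝ᵥ x i) * (w₀ ⬝ᵥ x i) = S at hδ ⊢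
  rw [hv₀]
  have hinv : (n : ℝ)⁻¹ * n = 1 := inv_mul_cancel₀ hn'
  have hfrac : r ^ 2 * γ ^ 2 / (1 + γ ^ 2) = r ^ 2 - r * (r / (1 + γ ^ 2)) := by
    field_simp; ring
  have hr : r / (1 + γ ^ 2) * (1 + γ ^ 2) = r := div_mul_cancel₀ _ hγ'
  rw [hfrac] at hδ
  generalize r / (1 + γ ^ 2) = t at *
  linear_combination 2 * hδ - 2 * (w₀ ⬝ᵥ empMean x) * η j₀ * hr +
    2 * (r * (-t * (w₀ ⬝ᵥ empMean x)) * (δ ⬝ᵥ empMean x) + r * η j₀ * (w₀ ⬝ᵥ empMean x) +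
      (-t * (w₀ ⬝ᵥ empMean x)) * η j₀) * hinv

end Quadratic

/-- With a standard basis vector `c ∈ ℝ^p`, the corrupted objective
`J^c(W,V) = (1/n) ∑ᵢ E_{ε,ξ} ‖rWxᵢ + σWε + V(c+γξ) − ε‖₂²` has the unique global
minimizer `W* = σA⁻¹`, `V* = b* cᵀ` with `b* = −(rσ/(1+γ²)) A⁻¹ μ̂`, where
`A = σ²I + r²Σ̂ + (r²γ²/(1+γ²)) μ̂μ̂ᵀ` is positive definite. -/
theorem stmt_5 (d p n : ℕ) (hn : 0 < n) (x : Fin n → Fin d → ℝ) (r σ γ : ℝ)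
    (hσ : 0 < σ) (hγ : 0 < γ) (j₀ : Fin p) (c : Fin p → ℝ) (hc : c = Pi.single j₀ 1)
    (Jc : Matrix (Fin d) (Fin d) ℝ → Matrix (Fin d) (Fin p) ℝ → ℝ)
    (hJc : ∀ W V, Jc W V =
      (n : ℝ)⁻¹ * ∑ i,
        ∫ q, sqNorm (r • (W *ᵥ x i) + σ • (W *ᵥ q.1) + V *ᵥ (c + γ • q.2) - q.1)
          ∂((stdGaussian d).prod (stdGaussian p)))
    (A : Matrix (Fin d) (Fin d) ℝ)
    (hA : A = σ ^ 2 • (1 : Matrix (Fin d) (Fin d) ℝ) + r ^ 2 • empCov x +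
        (r ^ 2 * γ ^ 2 / (1 + γ ^ 2)) • vecMulVec (empMean x) (empMean x)) :
    A.PosDef ∧
    (∀ W V, Jc (σ • A⁻¹) (vecMulVec (-((r * σ / (1 + γ ^ 2)) • (A⁻¹ *ᵥ empMean x))) c) ≤ Jc W V) ∧
    (∀ W V, Jc W V = Jc (σ • A⁻¹) (vecMulVec (-((r * σ / (1 + γ ^ 2)) • (A⁻¹ *ᵥ empMean x))) c) →
      W = σ • A⁻¹ ∧ V = vecMulVec (-((r * σ / (1 + γ ^ 2)) • (A⁻¹ *ᵥ empMean x))) c) := by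
  have hpd : A.PosDef := hA ▸ posDef_smul_one_add_empCov_add x hσ
  have hdet : IsUnit A.det := (isUnit_iff_isUnit_det A).1 hpd.isUnit
  have hsymm : A⁻¹ᵀ = A⁻¹ := by
    simpa [conjTranspose_eq_transpose_of_trivial] using hpd.isHermitian.inv.eq
  set W₀ := σ • A⁻¹ with hW₀
  set V₀ := vecMulVec (-((r * σ / (1 + γ ^ 2)) • (A⁻¹ *ᵥ empMean x))) c with hV₀
  have hw : ∀ k, A *ᵥ W₀ k = σ • Pi.single k 1 := by
    intro k
    have hk : W₀ k = σ • (A⁻¹ *ᵥ Pi.single k 1) := by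
      rw [mulVec_single_one, ← hsymm]; rfl
    rw [hk, mulVec_smul, mulVec_mulVec, mul_nonsing_inv A hdet, one_mulVec]
  have hv : ∀ k, V₀ k = Pi.single j₀ (-(r / (1 + γ ^ 2)) * (W₀ k ⬝ᵥ empMean x)) := by
    intro k
    have hk : W₀ k ⬝ᵥ empMean x = σ * (A⁻¹ *ᵥ empMean x) k := smul_dotProduct σ (A⁻¹ k) _
    ext j
    rw [hk, hV₀, vecMulVec_apply, hc]
    rcases eq_or_ne j j₀ with rfl | hj
    · simp; ring
    · simp [hj]
  have hJ : ∀ W V, Jc W V = Jc W₀ V₀ + ∑ k, rowLoss x r σ γ j₀ 0 (W k - W₀ k) (V k - V₀ k) := by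
    intro W V
    rw [hJc, hJc, hc, inv_mul_sum_integral_sqNorm hn, inv_mul_sum_integral_sqNorm hn,
      ← Finset.sum_add_distrib]
    exact Finset.sum_congr rfl fun k _ =>
      rowLoss_eq_add hn x r σ γ j₀ (hA ▸ hw k) (hv k) (W k) (V k)
  have hnonneg : ∀ (W : Matrix (Fin d) (Fin d) ℝ) (V : Matrix (Fin d) (Fin p) ℝ), ∀ k ∈ Finset.univ,
      0 ≤ rowLoss x r σ γ j₀ 0 (W k - W₀ k) (V k - V₀ k) :=
    fun W V k _ => rowLoss_zero_nonneg x r σ γ j₀ _ _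
  refine ⟨hpd, fun W V => ?_, fun W V h => ?_⟩
  · rw [hJ W V]
    exact le_add_of_nonneg_right (Finset.sum_nonneg (hnonneg W V))
  · rw [hJ W V, add_eq_left, Finset.sum_eq_zero_iff_of_nonneg (hnonneg W V)] at h
    have hk := fun k => eq_zero_of_rowLoss_zero_eq_zero hσ hγ (h k (Finset.mem_univ k))
    exact ⟨funext fun k => sub_eq_zero.1 (hk k).1, funext fun k => sub_eq_zero.1 (hk k).2⟩
end

section
/- Let x₁,…,x_n ∈ ℝ^d have empirical mean μ̂ and empirical covariance Σ̂, and assume Σ̂ is positive definite. For T > 0 and t ∈ [0,T] set r_t := e^{t−T}, σ_t² := 1 − e^{2(t−T)}. Consider the reverse ODE z'(t) = z(t) − (σ_t² I_d + r_t² Σ̂)^{-1} z(t) + r_t (σ_t² I_d + r_t² Σ̂)^{-1} μ̂ on [0,T] with random initial condition z(0) ~ N(0, I_d). Then z(T) is a Gaussian random vector, and as T → ∞ its law converges weakly to N(μ̂, Σ̂). -/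
open MeasureTheory ProbabilityTheory Matrix Real Filter

/-- The Lebesgue density of the Gaussian `N(m, S)` on `ℝ^d`
(for `S` positive definite). -/
noncomputable def gaussianPdf {d : ℕ} (m : Fin d → ℝ) (S : Matrix (Fin d) (Fin d) ℝ)
    (x : Fin d → ℝ) : ℝ :=
  (2 * π) ^ (-(d : ℝ) / 2) * S.det ^ (-(1 : ℝ) / 2) *
    Real.exp (-(1 / 2) * ((x - m) ⬝ᵥ (S⁻¹ *ᵥ (x - m))))

/-- The multivariate Gaussian measure `N(m, S)` on `ℝ^d`, defined through its
Lebesgue density. -/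
noncomputable def multivariateGaussian {d : ℕ} (m : Fin d → ℝ)
    (S : Matrix (Fin d) (Fin d) ℝ) : Measure (Fin d → ℝ) :=
  volume.withDensity fun x => ENNReal.ofReal (gaussianPdf m S x)

/-- The matrix `σ_t² I + r_t² B` with `r_t = e^{t−T}`, `σ_t² = 1 − e^{2(t−T)}`. -/
noncomputable def Mmat {d : ℕ} (B : Matrix (Fin d) (Fin d) ℝ) (T t : ℝ) :
    Matrix (Fin d) (Fin d) ℝ :=
  (1 - Real.exp (2 * (t - T))) • (1 : Matrix (Fin d) (Fin d) ℝ) +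
    Real.exp (2 * (t - T)) • B


theorem stdGaussian_eq_withDensity (d : ℕ) :
    (stdGaussian d : Measure (Fin d → ℝ)) = volume.withDensity
      fun v => ENNReal.ofReal (∏ i, gaussianPDFReal 0 1 (v i)) := by
  refine Measure.pi_eq fun s hs => ?_
  have hpdf : ∀ i, Integrable (gaussianPDFReal 0 1) (volume.restrict (s i)) := fun i =>
    (integrable_gaussianPDFReal 0 1).restrict
  rw [withDensity_apply _ (MeasurableSet.univ_pi hs), volume_pi, Measure.restrict_pi_pi,
    ← ofReal_integral_eq_lintegral_ofReal (Integrable.fintype_prod hpdf)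
      (ae_of_all _ fun v => Finset.prod_nonneg fun i _ => gaussianPDFReal_nonneg 0 1 _),
    integral_fintype_prod_eq_prod,
    ENNReal.ofReal_prod_of_nonneg fun i _ => integral_nonneg (gaussianPDFReal_nonneg 0 1)]
  exact Finset.prod_congr rfl fun i _ => (gaussianReal_apply_eq_integral 0 one_ne_zero _).symm

theorem prod_gaussianPDFReal {d : ℕ} (v : Fin d → ℝ) :
    ∏ i, gaussianPDFReal 0 1 (v i) =
      (2 * π) ^ (-(d : ℝ) / 2) * Real.exp (-(1 / 2) * (v ⬝ᵥ v)) := by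
  simp only [gaussianPDFReal, Finset.prod_mul_distrib, ← Real.exp_sum, Finset.prod_const,
    Finset.card_univ, Fintype.card_fin]
  congr 1
  · rw [Real.sqrt_eq_rpow, ← Real.rpow_neg (by positivity), ← Real.rpow_natCast,
      ← Real.rpow_mul (by positivity)]
    simp only [NNReal.coe_one, mul_one]
    congr 1
    ring
  · simp only [dotProduct, Finset.mul_sum]
    congr 1
    refine Finset.sum_congr rfl fun i _ => ?_
    simp
    ring

theorem gaussianPdf_affine {d : ℕ} {A : Matrix (Fin d) (Fin d) ℝ} (hA : A.det ≠ 0)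
    (b v : Fin d → ℝ) :
    |A.det| * gaussianPdf b (A * Aᵀ) (A *ᵥ v + b) = ∏ i, gaussianPDFReal 0 1 (v i) := by
  have hu : IsUnit A.det := hA.isUnit
  have hut : IsUnit Aᵀ.det := by rwa [det_transpose]
  have hq : (A *ᵥ v) ⬝ᵥ ((A * Aᵀ)⁻¹ *ᵥ (A *ᵥ v)) = v ⬝ᵥ v := by
    rw [Matrix.mul_inv_rev, mulVec_mulVec, Matrix.mul_assoc, nonsing_inv_mul _ hu, Matrix.mul_one,
      dotProduct_comm, dotProduct_mulVec, ← mulVec_transpose, mulVec_mulVec,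
      mul_nonsing_inv _ hut, one_mulVec]
  have hd : |A.det| * (A * Aᵀ).det ^ (-(1 : ℝ) / 2) = 1 := by
    have h : 0 < |A.det| := abs_pos.2 hA
    rw [det_mul, det_transpose, ← abs_mul_abs_self, ← pow_two, ← Real.rpow_natCast,
      ← Real.rpow_mul h.le]
    norm_num [Real.rpow_neg_one, h.ne']
  rw [prod_gaussianPDFReal, gaussianPdf, add_sub_cancel_right, hq]
  linear_combination (2 * π) ^ (-(d : ℝ) / 2) * Real.exp (-(1 / 2) * (v ⬝ᵥ v)) * hd

@[fun_prop]
theorem continuous_gaussianPdf {d : ℕ} (m : Fin d → ℝ) (S : Matrix (Fin d) (Fin d) ℝ) :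
    Continuous (gaussianPdf m S) := by
  unfold gaussianPdf
  fun_prop

theorem map_affine_stdGaussian {d : ℕ} {A : Matrix (Fin d) (Fin d) ℝ} (hA : A.det ≠ 0)
    (b : Fin d → ℝ) :
    Measure.map (fun v => A *ᵥ v + b) (stdGaussian d) = multivariateGaussian b (A * Aᵀ) := by
  have hm : Measurable fun v : Fin d → ℝ => A *ᵥ v + b := by fun_prop
  have hg : Measurable fun y => ENNReal.ofReal (gaussianPdf b (A * Aᵀ) y) := by fun_prop
  have hvol : Measure.map (fun v : Fin d → ℝ => A *ᵥ v + b) volume =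
      ENNReal.ofReal |A.det|⁻¹ • (volume : Measure (Fin d → ℝ)) := by
    have := Real.map_matrix_volume_pi_eq_smul_volume_pi hA
    rw [← abs_inv,
      show (fun v : Fin d → ℝ => A *ᵥ v + b) = (fun y => y + b) ∘ ⇑(toLin' A) from rfl,
      ← Measure.map_map (by fun_prop) (by fun_prop), this, Measure.map_smul, map_add_right_eq_self]
  ext s hs
  rw [Measure.map_apply hm hs, stdGaussian_eq_withDensity, _root_.multivariateGaussian,
    withDensity_apply _ (hm hs), withDensity_apply _ hs]
  simp_rw [← gaussianPdf_affine hA b, ENNReal.ofReal_mul (abs_nonneg A.det)]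
  rw [lintegral_const_mul _ (by fun_prop),
    ← setLIntegral_map hs hg hm, hvol, Measure.restrict_smul, lintegral_smul_measure, smul_eq_mul,
    ← mul_assoc, ← ENNReal.ofReal_mul (abs_nonneg _), mul_inv_cancel₀ (abs_pos.2 hA).ne',
    ENNReal.ofReal_one, one_mul]

theorem Matrix.PosDef.exists_diagonalization {d : ℕ} {B : Matrix (Fin d) (Fin d) ℝ}
    (hB : B.PosDef) : ∃ (U : Matrix (Fin d) (Fin d) ℝ) (l : Fin d → ℝ),
      U * Uᵀ = 1 ∧ Uᵀ * U = 1 ∧ (∀ i, 0 < l i) ∧ B = U * diagonal l * Uᵀ := by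
  refine ⟨hB.isHermitian.eigenvectorUnitary, hB.isHermitian.eigenvalues, ?_, ?_,
    hB.eigenvalues_pos, ?_⟩
  · simpa [star_eq_conjTranspose] using Unitary.coe_mul_star_self hB.isHermitian.eigenvectorUnitary
  · simpa [star_eq_conjTranspose] using Unitary.coe_star_mul_self hB.isHermitian.eigenvectorUnitary
  · conv_lhs => rw [hB.isHermitian.spectral_theorem]
    simp [star_eq_conjTranspose, Unitary.conjStarAlgAut_apply]

/-- The scalar version of the reverse ODE, as it reads along an eigenvector of the covariance. -/
theorem scalar_reverse_ode {T l ν : ℝ} {w m : ℝ → ℝ} (hT : 0 < T) (hl : 0 < l)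
    (hm : ∀ t, m t = 1 - Real.exp (2 * (t - T)) + Real.exp (2 * (t - T)) * l)
    (hw : ∀ t ∈ Set.Icc (0 : ℝ) T,
      HasDerivAt w (w t - (m t)⁻¹ * w t + Real.exp (t - T) * ((m t)⁻¹ * ν)) t) :
    w T = √l / √(m 0) * (w 0 - Real.exp (-T) * ν) + ν := by
  have hmpos : ∀ t ∈ Set.Icc (0 : ℝ) T, 0 < m t := fun t ht => by
    have h1 : Real.exp (2 * (t - T)) ≤ 1 := Real.exp_le_one_iff.2 (by linarith [ht.2])
    have h2 : 0 < Real.exp (2 * (t - T)) * l := by positivity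
    rw [hm]
    linarith
  have hmd : ∀ t, HasDerivAt m (2 * (m t - 1)) t := fun t => by
    have he : HasDerivAt (fun t => Real.exp (2 * (t - T))) (Real.exp (2 * (t - T)) * 2) t := by
      simpa using (((hasDerivAt_id t).sub_const T).const_mul 2).exp
    rw [funext hm]
    convert! (he.const_sub 1).add (he.mul_const l) using 1
    ring
  have hgd : ∀ t ∈ Set.Icc (0 : ℝ) T,
      HasDerivAt (fun t => (w t - Real.exp (t - T) * ν) / √(m t)) 0 t := fun t ht => by
    have hp := hmpos t ht
    have he : HasDerivAt (fun t => Real.exp (t - T)) (Real.exp (t - T)) t := by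
      simpa using ((hasDerivAt_id t).sub_const T).exp
    convert! ((hw t ht).sub (he.mul_const ν)).div ((hmd t).sqrt hp.ne') (Real.sqrt_pos.2 hp).ne'
      using 1
    have hs : √(m t) ≠ 0 := (Real.sqrt_pos.2 hp).ne'
    have hsq : m t = √(m t) ^ 2 := (Real.sq_sqrt hp.le).symm
    generalize √(m t) = s at hs hsq ⊢
    rw [hsq]
    simp only [Pi.sub_apply]
    field_simp
    ring
  have hconst := constant_of_has_deriv_right_zero
    (fun t ht => (hgd t ht).continuousAt.continuousWithinAt)
    (fun t ht => (hgd t (Set.Ico_subset_Icc_self ht)).hasDerivWithinAt) T ⟨hT.le, le_rfl⟩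
  have hmT : m T = l := by simp [hm]
  have hs := (Real.sqrt_pos.2 hl).ne'
  rw [hmT, sub_self, Real.exp_zero, one_mul, zero_sub, div_eq_iff hs] at hconst
  linear_combination hconst

section Diagonalized

variable {d : ℕ} {U : Matrix (Fin d) (Fin d) ℝ}

theorem conj_diagonal_mul (hU' : Uᵀ * U = 1) (a b : Fin d → ℝ) :
    U * diagonal a * Uᵀ * (U * diagonal b * Uᵀ) = U * diagonal (fun i => a i * b i) * Uᵀ := by
  rw [← diagonal_mul_diagonal]
  calc _ = U * diagonal a * (Uᵀ * U) * diagonal b * Uᵀ := by simp only [Matrix.mul_assoc]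
    _ = _ := by rw [hU', Matrix.mul_one]; simp only [Matrix.mul_assoc]

theorem conj_diagonal_inv (hU : U * Uᵀ = 1) (hU' : Uᵀ * U = 1) {a : Fin d → ℝ}
    (ha : ∀ i, a i ≠ 0) :
    (U * diagonal a * Uᵀ)⁻¹ = U * diagonal (fun i => (a i)⁻¹) * Uᵀ := by
  refine inv_eq_right_inv ?_
  simp [conj_diagonal_mul hU', ha, hU]

theorem conj_diagonal_det_ne_zero (hU : U * Uᵀ = 1) (hU' : Uᵀ * U = 1) {a : Fin d → ℝ}
    (ha : ∀ i, a i ≠ 0) : (U * diagonal a * Uᵀ).det ≠ 0 := by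
  refine det_ne_zero_of_right_inverse (B := U * diagonal (fun i => (a i)⁻¹) * Uᵀ) ?_
  simp [conj_diagonal_mul hU', ha, hU]

theorem conj_diagonal_mul_transpose (hU' : Uᵀ * U = 1) (a : Fin d → ℝ) :
    U * diagonal a * Uᵀ * (U * diagonal a * Uᵀ)ᵀ = U * diagonal (fun i => a i * a i) * Uᵀ := by
  rw [← conj_diagonal_mul hU']
  simp [Matrix.mul_assoc]

theorem Mmat_conj_diagonal (hU : U * Uᵀ = 1) (l : Fin d → ℝ) (T t : ℝ) :
    Mmat (U * diagonal l * Uᵀ) T t = U * diagonal (fun i =>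
      1 - Real.exp (2 * (t - T)) + Real.exp (2 * (t - T)) * l i) * Uᵀ := by
  have : diagonal (fun i => 1 - Real.exp (2 * (t - T)) + Real.exp (2 * (t - T)) * l i) =
      (1 - Real.exp (2 * (t - T))) • (1 : Matrix (Fin d) (Fin d) ℝ) +
        Real.exp (2 * (t - T)) • diagonal l := by
    rw [smul_one_eq_diagonal, ← diagonal_smul, diagonal_add]
    rfl
  rw [Mmat, this, Matrix.mul_add, Matrix.add_mul]
  simp [hU]

/-- The square root of `Σ̂ M₀⁻¹` on the eigenvalue `l` of `Σ̂`. -/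
noncomputable def flowFactor (l T : ℝ) : ℝ :=
  √l / √(1 - Real.exp (2 * (0 - T)) + Real.exp (2 * (0 - T)) * l)

theorem flowFactor_pos {l T : ℝ} (hl : 0 < l) (hT : 0 < T) : 0 < flowFactor l T := by
  have h1 : Real.exp (2 * (0 - T)) ≤ 1 := Real.exp_le_one_iff.2 (by linarith)
  have h2 : 0 < Real.exp (2 * (0 - T)) * l := by positivity
  exact div_pos (Real.sqrt_pos.2 hl) (Real.sqrt_pos.2 (by linarith))

theorem tendsto_flowFactor (l : ℝ) : Tendsto (flowFactor l) atTop (nhds √l) := by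
  have he : Tendsto (fun T : ℝ => Real.exp (2 * (0 - T))) atTop (nhds 0) := by
    refine Real.tendsto_exp_atBot.comp ?_
    simp only [zero_sub]
    exact tendsto_neg_atTop_atBot.const_mul_atBot two_pos
  have h : Tendsto (flowFactor l) atTop (nhds (√l / √(1 - 0 + 0 * l))) :=
    tendsto_const_nhds.div ((he.const_sub 1).add (he.mul_const l)).sqrt (by simp)
  simpa using h

theorem reverse_ode_terminal_value (hU : U * Uᵀ = 1) (hU' : Uᵀ * U = 1) {l : Fin d → ℝ}
    (hl : ∀ i, 0 < l i) {T : ℝ} (hT : 0 < T) (μ : Fin d → ℝ) {y : ℝ → Fin d → ℝ}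
    (hy : ∀ t ∈ Set.Icc (0 : ℝ) T,
      HasDerivAt y (y t - (Mmat (U * diagonal l * Uᵀ) T t)⁻¹ *ᵥ y t +
        Real.exp (t - T) • ((Mmat (U * diagonal l * Uᵀ) T t)⁻¹ *ᵥ μ)) t) :
    y T = (U * diagonal (fun i => flowFactor (l i) T) * Uᵀ) *ᵥ y 0 +
      (μ - Real.exp (-T) • ((U * diagonal (fun i => flowFactor (l i) T) * Uᵀ) *ᵥ μ)) := by
  have hm : ∀ t ∈ Set.Icc (0 : ℝ) T, ∀ i,
      1 - Real.exp (2 * (t - T)) + Real.exp (2 * (t - T)) * l i ≠ 0 := fun t ht i => by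
    have h1 : Real.exp (2 * (t - T)) ≤ 1 := Real.exp_le_one_iff.2 (by linarith [ht.2])
    have h2 : 0 < Real.exp (2 * (t - T)) * l i := mul_pos (Real.exp_pos _) (hl i)
    linarith
  have hcancel : ∀ (D : Matrix (Fin d) (Fin d) ℝ) (v : Fin d → ℝ),
      Uᵀ *ᵥ ((U * D * Uᵀ) *ᵥ v) = D *ᵥ (Uᵀ *ᵥ v) := fun D v => by
    rw [mulVec_mulVec, mulVec_mulVec, ← Matrix.mul_assoc, ← Matrix.mul_assoc, hU', Matrix.one_mul]
  have hcoord : ∀ i, (Uᵀ *ᵥ y T) i = flowFactor (l i) T *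
      ((Uᵀ *ᵥ y 0) i - Real.exp (-T) * (Uᵀ *ᵥ μ) i) + (Uᵀ *ᵥ μ) i := fun i => by
    refine scalar_reverse_ode (w := fun t => (Uᵀ *ᵥ y t) i) hT (hl i) (fun t => rfl)
      fun t ht => ?_
    have h := Uᵀ.mulVecLin.toContinuousLinearMap.hasFDerivAt.comp_hasDerivAt t (hy t ht)
    have h := (hasDerivAt_pi.1 h) i
    rw [Mmat_conj_diagonal hU, conj_diagonal_inv hU hU' (hm t ht)] at h
    convert! h using 1
    simp [-mulVecLin_transpose, -mulVec_mulVec, mulVec_add, mulVec_sub, mulVec_smul, hcancel,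
      mulVec_diagonal]
  have hvec : Uᵀ *ᵥ y T = Uᵀ *ᵥ ((U * diagonal (fun i => flowFactor (l i) T) * Uᵀ) *ᵥ y 0 +
      (μ - Real.exp (-T) • ((U * diagonal (fun i => flowFactor (l i) T) * Uᵀ) *ᵥ μ))) := by
    ext i
    rw [hcoord]
    simp only [mulVec_add, mulVec_sub, mulVec_smul, hcancel, mulVec_diagonal, Pi.add_apply,
      Pi.sub_apply, Pi.smul_apply, smul_eq_mul]
    ring
  simpa [mulVec_mulVec, hU] using congrArg (U *ᵥ ·) hvec

end Diagonalized

/-- Let `Σ̂` (positive definite) and `μ̂` be the empirical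
covariance and mean of `x₁,…,x_n`, and for each horizon `T > 0` let
`z T z₀ : [0,T] → ℝ^d` solve the reverse ODE
`z' = z − (σ_t²I + r_t²Σ̂)⁻¹ z + r_t (σ_t²I + r_t²Σ̂)⁻¹ μ̂` with `z T z₀ 0 = z₀`.
Then for `z₀ ∼ N(0, I_d)` the value `z T z₀ T` is a Gaussian random vector, and as
`T → ∞` its law converges weakly to `N(μ̂, Σ̂)`. -/
theorem stmt_10 (d n : ℕ) (hn : 0 < n) (x : Fin n → Fin d → ℝ)
    (hcov : (empCov x).PosDef)
    (z : ℝ → (Fin d → ℝ) → ℝ → Fin d → ℝ)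
    (hz0 : ∀ T > (0 : ℝ), ∀ v, z T v 0 = v)
    (hode : ∀ T > (0 : ℝ), ∀ v, ∀ t ∈ Set.Icc (0 : ℝ) T,
      HasDerivAt (z T v)
        (z T v t - (Mmat (empCov x) T t)⁻¹ *ᵥ z T v t +
          Real.exp (t - T) • ((Mmat (empCov x) T t)⁻¹ *ᵥ empMean x)) t) :
    (∀ T > (0 : ℝ), ∃ (mT : Fin d → ℝ) (ST : Matrix (Fin d) (Fin d) ℝ), ST.PosDef ∧
        Measure.map (fun v => z T v T) (stdGaussian d) = multivariateGaussian mT ST) ∧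
    ∀ f : BoundedContinuousFunction (Fin d → ℝ) ℝ,
      Tendsto (fun T => ∫ v, f (z T v T) ∂stdGaussian d) atTop
        (nhds (∫ y, f y ∂multivariateGaussian (empMean x) (empCov x))) := by
  obtain ⟨U, l, hU, hU', hl, hB⟩ := hcov.exists_diagonalization
  set A : ℝ → Matrix (Fin d) (Fin d) ℝ :=
    fun T => U * diagonal (fun i => flowFactor (l i) T) * Uᵀ
  have hz : ∀ T > (0 : ℝ), ∀ v, z T v T =
      A T *ᵥ v + (empMean x - Real.exp (-T) • (A T *ᵥ empMean x)) := fun T hT v => by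
    have h := hode T hT v
    rw [hB] at h
    simpa [hz0 T hT v] using reverse_ode_terminal_value hU hU' hl hT (empMean x) h
  refine ⟨fun T hT => ?_, fun f => ?_⟩
  · have hdet : (A T).det ≠ 0 :=
      conj_diagonal_det_ne_zero hU hU' fun i => (flowFactor_pos (hl i) hT).ne'
    refine ⟨empMean x - Real.exp (-T) • (A T *ᵥ empMean x), A T * (A T)ᵀ, ?_, ?_⟩
    · rw [← conjTranspose_eq_transpose_of_trivial]
      exact PosDef.mul_conjTranspose_self _
        (vecMul_injective_of_isUnit ((isUnit_iff_isUnit_det _).2 hdet.isUnit))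
    · simp_rw [hz T hT]
      exact map_affine_stdGaussian hdet _
  · have hAlim : Tendsto A atTop (nhds (U * diagonal (fun i => √(l i)) * Uᵀ)) := by
      have hcont : Continuous fun a : Fin d → ℝ => U * diagonal a * Uᵀ := by fun_prop
      exact (hcont.tendsto _).comp (tendsto_pi_nhds.2 fun i => tendsto_flowFactor (l i))
    have hvlim : ∀ v, Tendsto (fun T => A T *ᵥ v) atTop
        (nhds ((U * diagonal (fun i => √(l i)) * Uᵀ) *ᵥ v)) := fun v =>
      ((continuous_id.matrix_mulVec continuous_const).tendsto _).comp hAlim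
    have hlimlaw : multivariateGaussian (empMean x) (empCov x) =
        Measure.map (fun v => (U * diagonal (fun i => √(l i)) * Uᵀ) *ᵥ v + empMean x)
          (stdGaussian d) := by
      rw [map_affine_stdGaussian
        (conj_diagonal_det_ne_zero hU hU' fun i => (Real.sqrt_pos.2 (hl i)).ne'),
        conj_diagonal_mul_transpose hU']
      simp_rw [Real.mul_self_sqrt (hl _).le]
      rw [← hB]
    have : IsProbabilityMeasure (stdGaussian d : Measure (Fin d → ℝ)) := by
      unfold _root_.stdGaussian
      infer_instance
    rw [hlimlaw, integral_map (by fun_prop) f.continuous.aestronglyMeasurable]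
    refine tendsto_integral_filter_of_dominated_convergence (fun _ => ‖f‖) ?_ ?_
      (integrable_const _) (ae_of_all _ fun v => ?_)
    · filter_upwards [eventually_gt_atTop 0] with T hT
      simp_rw [hz T hT]
      exact (f.continuous.comp (by fun_prop)).aestronglyMeasurable
    · exact Eventually.of_forall fun T => ae_of_all _ fun v => f.norm_coe_le_norm _
    · refine (f.continuous.tendsto _).comp ?_
      have hb : Tendsto (fun T => Real.exp (-T) • (A T *ᵥ empMean x)) atTop (nhds 0) := by
        simpa using (Real.tendsto_exp_neg_atTop_nhds_zero).smul (hvlim (empMean x))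
      have h := (hvlim v).add (hb.const_sub (empMean x))
      rw [sub_zero] at h
      refine h.congr' ?_
      filter_upwards [eventually_gt_atTop 0] with T hT
      exact (hz T hT v).symm
end
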